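/- Charge-lattice basis change for a rational electric θ angle (Section 6.1.2 of the paper): let p be a positive integer and q, s integers with s·q ≡ 1 (mod p). Then in the additive group ℚ × ℚ, the subgroup generated by the two elements (0, 1) and (1, q/p) is equal to the subgroup generated by the two elements (p, 0) and (s, 1/p). (Hence the spectrum of genuine line operators produced by the electric θ angle θ_e = 2πq/p coincides with that produced by a magnetic θ angle θ_m = 2πs/p after rescaling the coupling g → gp.) -/

import Mathlib

/-- Charge-lattice basis change for a rational electric θ angle
(Section 6.1.2): if s·q ≡ 1 (mod p), the subgroup of ℚ × ℚ generated by
(0,1) and (1,q/p) equals the one generated by (p,0) and (s,1/p). -/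
theorem stmt_12 (p : ℤ) (hp : 0 < p) (q s : ℤ) (h : p ∣ s * q - 1) :
    AddSubgroup.closure
        ({((0 : ℚ), (1 : ℚ)), ((1 : ℚ), (q : ℚ) / (p : ℚ))} : Set (ℚ × ℚ))
      = AddSubgroup.closure
          ({((p : ℚ), (0 : ℚ)), ((s : ℚ), 1 / (p : ℚ))} : Set (ℚ × ℚ)) := by
  obtain ⟨k, hk⟩ := h
  have hp0 : (p : ℚ) ≠ 0 := by exact_mod_cast hp.ne'
  have hkQ : (s : ℚ) * q - 1 = p * k := by exact_mod_cast hk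
  apply le_antisymm <;> rw [AddSubgroup.closure_le] <;> rintro _ (rfl | rfl) <;>
    rw [SetLike.mem_coe, AddSubgroup.mem_closure_pair]
  · refine ⟨-s, p, Prod.ext ?_ ?_⟩ <;> simp <;> field_simp
    ring
  · refine ⟨-k, q, Prod.ext ?_ ?_⟩ <;> simp <;> field_simp
    linarith
  · refine ⟨-q, p, Prod.ext ?_ ?_⟩ <;> simp <;> field_simp
    ring
  · refine ⟨-k, s, Prod.ext ?_ ?_⟩ <;> simp <;> field_simp
    linarith
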